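/- Let 1 ≤ l ≤ k, let u(x,t) = u_0(x − t) with u_0 : ℝ → ℝ of class C^{k+l+2}, and let u_h be a DG solution on [0,T] (with either the periodic upwind flux, u_0 being 2π-periodic, or the Dirichlet inflow flux). Then there is a constant C depending only on k, l and the quasi-uniformity constant c such that for all t ∈ [0,T], ‖u_I^l(·,t) − u_h(·,t)‖_0 ≤ ‖u_I^l(·,0) − u_h(·,0)‖_0 + C t h^{k+l+1} M_{k+l+2}. -/

import Mathlib

open MeasureTheory intervalIntegral

/-- Legendre polynomial of degree `m` via the Rodrigues formula. -/
noncomputable def legendreP (m : ℕ) : ℝ → ℝ :=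
  fun s => (1 / ((2:ℝ) ^ m * (Nat.factorial m : ℝ))) *
    iteratedDeriv m (fun t : ℝ => (t ^ 2 - 1) ^ m) s

/-- Legendre polynomial rescaled to the cell `(a, b)`. -/
noncomputable def legendreCell (m : ℕ) (a b : ℝ) : ℝ → ℝ :=
  fun x => legendreP m ((2 * x - (a + b)) / (b - a))

/-- `P` is the Gauss–Radau projection (onto polynomials of degree ≤ k on `(a,b)`) of `u`. -/
def IsGRProj (k : ℕ) (a b : ℝ) (u : ℝ → ℝ) (P : Polynomial ℝ) : Prop :=
  P.natDegree ≤ k ∧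
  (∀ v : Polynomial ℝ, v.natDegree + 1 ≤ k →
    (∫ x in a..b, P.eval x * v.eval x) = ∫ x in a..b, u x * v.eval x) ∧
  P.eval b = u b

/-- The scaled primitive `(D⁻¹ v)(x) = (2/(b-a)) ∫_a^x v`. -/
noncomputable def Dinv (a b : ℝ) (v : ℝ → ℝ) : ℝ → ℝ :=
  fun x => (2 / (b - a)) * ∫ t in a..x, v t

/-- `F` is the sequence of correction polynomials on the cell `(a,b)`:
`F 1 = P_h^-(D⁻¹ L_k)` and `F i = -P_h^-(D⁻¹ F (i-1))` for `i ≥ 2`. -/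
def IsFSeq (k : ℕ) (a b : ℝ) (F : ℕ → Polynomial ℝ) : Prop :=
  IsGRProj k a b (Dinv a b (legendreCell k a b)) (F 1) ∧
  ∀ i, 2 ≤ i → IsGRProj k a b (Dinv a b (fun x => (F (i-1)).eval x)) (-(F i))

/-- The `m`-th Radau coefficient of `w` on the cell `(a,b)`. -/
noncomputable def radauCoeff (a b : ℝ) (w : ℝ → ℝ) (m : ℕ) : ℝ :=
  w b - (1 / (b - a)) *
    ∫ x in a..b, w x * ∑ l ∈ Finset.range m, (2 * (l:ℝ) + 1) * legendreCell l a b x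

/-- `G_i(t) = (d/dt)^i u_{j,k+1}(t)` for `u(x,t) = u0(x - t)` on the cell `(a,b)`. -/
noncomputable def Gfun (k : ℕ) (a b : ℝ) (u0 : ℝ → ℝ) (i : ℕ) (t : ℝ) : ℝ :=
  iteratedDeriv i (fun s => radauCoeff a b (fun y => u0 (y - s)) (k + 1)) t

/-- `w_i(x,t) = (h_j/2)^i G_i(t) F_i(x)` on the cell `(a,b)`. -/
noncomputable def wFun (k : ℕ) (a b : ℝ) (u0 : ℝ → ℝ) (F : ℕ → Polynomial ℝ)
    (i : ℕ) (y t : ℝ) : ℝ :=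
  ((b - a) / 2) ^ i * Gfun k a b u0 i t * (F i).eval y

/-- `w^l = Σ_{i=1}^l w_i` on the cell `(a,b)`. -/
noncomputable def wSum (k : ℕ) (a b : ℝ) (u0 : ℝ → ℝ) (F : ℕ → Polynomial ℝ)
    (l : ℕ) (y t : ℝ) : ℝ :=
  ∑ i ∈ Finset.Icc 1 l, wFun k a b u0 F i y t

/-- The interpolation function `u_I^l = P_h^- u - w^l` on the cell `(a,b)`;
here `P t` is the Gauss–Radau projection of `u(·,t)`. -/
noncomputable def uIl (k : ℕ) (a b : ℝ) (u0 : ℝ → ℝ) (P : ℝ → Polynomial ℝ)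
    (F : ℕ → Polynomial ℝ) (l : ℕ) (y t : ℝ) : ℝ :=
  (P t).eval y - wSum k a b u0 F l y t

/-- `uh` is a DG solution on `[0,T]` on the mesh `x 0 < x 1 < … < x N`
(the piece on the cell `τ_j = (x (j-1), x j)` is the polynomial `uh j t`),
with prescribed inflow value `inflow t` at the left boundary. -/
def IsDGSol (k N : ℕ) (x : ℕ → ℝ) (T : ℝ) (inflow : ℝ → ℝ)
    (uh : ℕ → ℝ → Polynomial ℝ) : Prop :=
  (∀ j ∈ Finset.Icc 1 N, ∀ t : ℝ, (uh j t).natDegree ≤ k) ∧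
  (∀ j ∈ Finset.Icc 1 N, ∀ y : ℝ, ContDiff ℝ 1 (fun t => (uh j t).eval y)) ∧
  (∀ j ∈ Finset.Icc 1 N, ∀ t ∈ Set.Icc (0:ℝ) T, ∀ v : Polynomial ℝ, v.natDegree ≤ k →
    (∫ y in (x (j-1))..(x j), deriv (fun s => (uh j s).eval y) t * v.eval y)
      - (∫ y in (x (j-1))..(x j), (uh j t).eval y * v.derivative.eval y)
      + (uh j t).eval (x j) * v.eval (x j)
      - (if j = 1 then inflow t else (uh (j-1) t).eval (x (j-1))) * v.eval (x (j-1)) = 0)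

/-- The error `u - u_I^l` on the cell `τ_j`, as a function of `(y, s)`. -/
noncomputable def errFun (k l : ℕ) (x : ℕ → ℝ) (u0 : ℝ → ℝ)
    (P : ℕ → ℝ → Polynomial ℝ) (F : ℕ → ℕ → Polynomial ℝ) (j : ℕ) (y s : ℝ) : ℝ :=
  u0 (y - s) - uIl k (x (j-1)) (x j) u0 (P j) (F j) l y s

open MeasureTheory intervalIntegral
open Polynomial

/-- Integral of a polynomial over `(a,b)` as a linear functional. -/
noncomputable def pI (a b : ℝ) : ℝ[X] →ₗ[ℝ] ℝ where
  toFun p := ∫ x in a..b, p.eval x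
  map_add' p q := by
    simp only [eval_add]
    exact intervalIntegral.integral_add (p.continuous.intervalIntegrable _ _)
      (q.continuous.intervalIntegrable _ _)
  map_smul' c p := by
    simp only [eval_smul, smul_eq_mul, RingHom.id_apply]
    exact intervalIntegral.integral_const_mul _ _

lemma pI_apply (a b : ℝ) (p : ℝ[X]) : pI a b p = ∫ x in a..b, p.eval x := rfl

lemma pI_C_mul (a b c : ℝ) (p : ℝ[X]) : pI a b (C c * p) = c * pI a b p := by
  rw [← smul_eq_C_mul, map_smul, smul_eq_mul]

lemma pI_deriv (a b : ℝ) (p : ℝ[X]) : pI a b (derivative p) = p.eval b - p.eval a := by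
  rw [pI_apply]
  exact intervalIntegral.integral_eq_sub_of_hasDerivAt (fun x _ => p.hasDerivAt x)
    ((derivative p).continuous.intervalIntegrable _ _)

lemma pI_ibp (a b : ℝ) (p q : ℝ[X]) :
    pI a b (derivative p * q) = p.eval b * q.eval b - p.eval a * q.eval a
      - pI a b (p * derivative q) := by
  have := pI_deriv a b (p * q)
  rw [derivative_mul, map_add, eval_mul, eval_mul] at this
  linarith

lemma pI_sq_nonneg {a b : ℝ} (hab : a ≤ b) (p : ℝ[X]) : 0 ≤ pI a b (p * p) := by
  rw [pI_apply]
  apply intervalIntegral.integral_nonneg hab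
  intro x _
  rw [eval_mul]; exact mul_self_nonneg _

lemma poly_eq_zero_of_Ioo {a b : ℝ} (hab : a < b) (p : ℝ[X])
    (h : ∀ x ∈ Set.Ioo a b, p.eval x = 0) : p = 0 := by
  apply eq_zero_of_infinite_isRoot
  exact (Set.Ioo_infinite hab).mono (fun x hx => h x hx)

lemma poly_zero_of_integral {a b : ℝ} (hab : a < b) (p : ℝ[X])
    (hnn : ∀ x ∈ Set.Icc a b, 0 ≤ p.eval x) (h : pI a b p = 0) : p = 0 := by
  apply poly_eq_zero_of_Ioo hab
  intro x hx
  by_contra hne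
  have hpos : 0 < p.eval x := lt_of_le_of_ne (hnn x ⟨hx.1.le, hx.2.le⟩) (Ne.symm hne)
  have : 0 < ∫ x in a..b, p.eval x :=
    intervalIntegral.integral_pos hab p.continuous.continuousOn
      (fun y hy => hnn y ⟨hy.1.le, hy.2⟩) ⟨x, ⟨hx.1.le, hx.2.le⟩, hpos⟩
  rw [pI_apply] at h
  linarith

lemma pI_sq_eq_zero {a b : ℝ} (hab : a < b) (p : ℝ[X]) (h : pI a b (p * p) = 0) : p = 0 := by
  have := poly_zero_of_integral hab (p * p) (fun x _ => by rw [eval_mul]; exact mul_self_nonneg _) h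
  exact mul_self_eq_zero.mp this

/-- Legendre polynomial as a `Polynomial`. -/
noncomputable def legPoly (m : ℕ) : ℝ[X] :=
  C (1 / ((2:ℝ) ^ m * (Nat.factorial m : ℝ))) * derivative^[m] ((X ^ 2 - 1) ^ m)

lemma iteratedDeriv_poly (p : ℝ[X]) (m : ℕ) :
    iteratedDeriv m (fun t : ℝ => p.eval t) = fun t => (derivative^[m] p).eval t := by
  induction m with
  | zero => simp
  | succ n ih =>
    rw [iteratedDeriv_succ, ih]
    funext t
    rw [Polynomial.deriv, Function.iterate_succ_apply']

lemma legendreP_eq (m : ℕ) (s : ℝ) : legendreP m s = (legPoly m).eval s := by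
  unfold legendreP legPoly
  have : (fun t : ℝ => (t ^ 2 - 1) ^ m) = fun t => ((X ^ 2 - 1 : ℝ[X]) ^ m).eval t := by
    funext t; simp
  rw [this, iteratedDeriv_poly]
  simp

lemma W_fac (m : ℕ) : ((X ^ 2 - 1 : ℝ[X]) ^ m) = (X - C 1) ^ m * (X - C (-1)) ^ m := by
  rw [← mul_pow]; congr 1; simp; ring

lemma W_root (m n : ℕ) (hn : n < m) (r : ℝ) (hr : r = 1 ∨ r = -1) :
    (derivative^[n] ((X ^ 2 - 1 : ℝ[X]) ^ m)).eval r = 0 := by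
  have h1 : (X - C r) ^ m ∣ ((X ^ 2 - 1 : ℝ[X]) ^ m) := by
    rw [W_fac]
    rcases hr with rfl | rfl
    · exact dvd_mul_right _ _
    · exact dvd_mul_left _ _
  have h2 := pow_sub_dvd_iterate_derivative_of_pow_dvd n h1
  have h3 : (X - C r) ∣ derivative^[n] ((X ^ 2 - 1 : ℝ[X]) ^ m) :=
    (dvd_pow_self _ (Nat.sub_ne_zero_of_lt hn)).trans h2
  exact dvd_iff_isRoot.mp h3

lemma eval_iter_deriv_mul (m : ℕ) (t : ℝ) (q : ℝ[X]) :
    (derivative^[m] ((X - C t) ^ m * q)).eval t = m.factorial * q.eval t := by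
  rw [iterate_derivative_mul, eval_finsetSum,
    Finset.sum_eq_single_of_mem _ (Finset.mem_range.mpr m.succ_pos)]
  · rw [m.choose_zero_right, one_smul, eval_mul, m.sub_zero, iterate_derivative_X_sub_pow_self,
      eval_natCast]; rfl
  · intro b hb hb0
    rw [iterate_derivative_X_sub_pow, eval_smul, eval_mul, eval_smul, eval_pow,
      Nat.sub_sub_self (Finset.mem_range_succ_iff.mp hb), eval_sub, eval_X, eval_C, sub_self,
      zero_pow hb0, smul_zero, zero_mul, smul_zero]

lemma legPoly_one (m : ℕ) : (legPoly m).eval 1 = 1 := by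
  unfold legPoly
  rw [eval_mul, eval_C, W_fac, eval_iter_deriv_mul]
  have : (m.factorial : ℝ) ≠ 0 := by positivity
  simp only [eval_pow, eval_sub, eval_X, eval_C]
  norm_num
  field_simp

lemma legPoly_neg_one_sq (m : ℕ) : (legPoly m).eval (-1) ^ 2 = 1 := by
  unfold legPoly
  rw [eval_mul, eval_C, W_fac, mul_comm ((X - C 1) ^ m), eval_iter_deriv_mul]
  have : (m.factorial : ℝ) ≠ 0 := by positivity
  simp only [eval_pow, eval_sub, eval_X, eval_C]
  have h2 : ((-1 - 1 : ℝ) ^ m) ^ 2 = (2 ^ m) ^ 2 := by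
    rw [← pow_mul, ← pow_mul, mul_comm m 2, pow_mul, pow_mul]; norm_num
  have h3 : ((2:ℝ) ^ m) ≠ 0 := by positivity
  rw [mul_pow, mul_pow, h2]
  field_simp

lemma leg_ibp (m : ℕ) (q : ℝ[X]) (n : ℕ) (hn : n ≤ m) :
    pI (-1) 1 (derivative^[n] ((X ^ 2 - 1 : ℝ[X]) ^ m) * q)
      = (-1) ^ n * pI (-1) 1 (((X ^ 2 - 1 : ℝ[X]) ^ m) * derivative^[n] q) := by
  induction n generalizing q with
  | zero => simp
  | succ n ih =>
    rw [Function.iterate_succ_apply', pI_ibp, W_root m n (by omega) 1 (Or.inl rfl),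
      W_root m n (by omega) (-1) (Or.inr rfl), ih _ (by omega), Function.iterate_succ_apply, pow_succ]
    ring

lemma leg_orth (m : ℕ) (q : ℝ[X]) (hq : q.degree < m) : pI (-1) 1 (legPoly m * q) = 0 := by
  unfold legPoly
  rw [mul_assoc, pI_C_mul, leg_ibp m q m le_rfl]
  have : derivative^[m] q = 0 := by
    rcases eq_or_ne q 0 with rfl | h0
    · simp
    · exact iterate_derivative_eq_zero ((natDegree_lt_iff_degree_lt h0).mpr hq)
  rw [this]; simp

lemma legPoly_natDegree_le (m : ℕ) : (legPoly m).natDegree ≤ m := by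
  unfold legPoly
  refine (natDegree_C_mul_le _ _).trans ?_
  refine (natDegree_iterate_derivative _ _).trans ?_
  have : ((X ^ 2 - 1 : ℝ[X]) ^ m).natDegree ≤ m * 2 := by
    refine natDegree_pow_le_of_le m ?_
    compute_degree
  omega

lemma leg_norm (m : ℕ) : pI (-1) 1 (legPoly m * legPoly m) = 2 / (2 * m + 1) := by
  have h1 : pI (-1) 1 (legPoly m * (X * derivative (legPoly m) - C (m:ℝ) * legPoly m)) = 0 := by
    apply leg_orth
    rw [degree_lt_iff_coeff_zero]
    intro i hi
    rcases Nat.eq_zero_or_pos i with rfl | hip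
    · have : m = 0 := by omega
      subst this; simp
    · obtain ⟨i, rfl⟩ : ∃ i', i = i' + 1 := ⟨i - 1, by omega⟩
      rw [coeff_sub, coeff_X_mul, coeff_derivative, coeff_C_mul]
      rcases Nat.lt_or_ge m (i + 1) with h | h
      · rw [coeff_eq_zero_of_natDegree_lt (lt_of_le_of_lt (legPoly_natDegree_le m) h)]; simp
      · have : m = i + 1 := by omega
        subst this; push_cast; ring
  have h2 := pI_ibp (-1) 1 (legPoly m) (X * legPoly m)
  rw [derivative_mul, derivative_X, one_mul, mul_add, map_add] at h2
  simp only [eval_mul, eval_X, legPoly_one] at h2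
  have h3 := legPoly_neg_one_sq m
  rw [mul_sub, map_sub, show legPoly m * (C (m:ℝ) * legPoly m) = C (m:ℝ) * (legPoly m * legPoly m) by ring,
    pI_C_mul] at h1
  rw [show derivative (legPoly m) * (X * legPoly m) = legPoly m * (X * derivative (legPoly m)) by ring] at h2
  have hm : (2 * (m:ℝ) + 1) ≠ 0 := by positivity
  rw [eq_div_iff hm]
  nlinarith


/-- affine map from the reference cell -/
noncomputable def phiP (a b : ℝ) : ℝ[X] := C ((b - a) / 2) * X + C ((a + b) / 2)

/-- affine map to the reference cell -/
noncomputable def psiP (a b : ℝ) : ℝ[X] := C (2 / (b - a)) * X - C ((a + b) / (b - a))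

/-- cell Legendre polynomial -/
noncomputable def Lc (a b : ℝ) (m : ℕ) : ℝ[X] := (legPoly m).comp (psiP a b)

lemma phi_psi {a b : ℝ} (hab : a < b) : (phiP a b).comp (psiP a b) = X := by
  have : b - a ≠ 0 := by linarith
  apply Polynomial.funext; intro r
  simp [phiP, psiP]
  field_simp; ring

lemma psi_phi {a b : ℝ} (hab : a < b) : (psiP a b).comp (phiP a b) = X := by
  have : b - a ≠ 0 := by linarith
  apply Polynomial.funext; intro r
  simp [phiP, psiP]
  field_simp; ring

lemma phi_eval (a b s : ℝ) : (phiP a b).eval s = (b - a) / 2 * s + (a + b) / 2 := by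
  simp [phiP]

lemma phi_natDegree (a b : ℝ) : (phiP a b).natDegree ≤ 1 := by
  unfold phiP; compute_degree

lemma psi_natDegree (a b : ℝ) : (psiP a b).natDegree ≤ 1 := by
  unfold psiP; compute_degree

lemma int_scale {a b : ℝ} (hab : a < b) (f : ℝ → ℝ) :
    ∫ x in a..b, f x = (b - a) / 2 * ∫ s in (-1:ℝ)..1, f ((b - a) / 2 * s + (a + b) / 2) := by
  have h : (b - a) / 2 ≠ 0 := by have : 0 < b - a := by linarith
                                 positivity
  rw [intervalIntegral.integral_comp_mul_add (fun x => f x) h, smul_eq_mul, ← mul_assoc,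
    mul_inv_cancel₀ h, one_mul]
  congr 1 <;> ring

lemma pI_scale {a b : ℝ} (hab : a < b) (p : ℝ[X]) :
    pI a b p = (b - a) / 2 * pI (-1) 1 (p.comp (phiP a b)) := by
  rw [pI_apply, int_scale hab, pI_apply]
  simp only [eval_comp, phi_eval]

lemma Lc_comp {a b : ℝ} (hab : a < b) (m : ℕ) : (Lc a b m).comp (phiP a b) = legPoly m := by
  rw [Lc, comp_assoc, psi_phi hab, comp_X]

lemma legendreCell_eq {a b : ℝ} (hab : a < b) (m : ℕ) (x : ℝ) :
    legendreCell m a b x = (Lc a b m).eval x := by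
  have : b - a ≠ 0 := by linarith
  unfold legendreCell
  rw [legendreP_eq, Lc, eval_comp]
  congr 1
  simp [psiP]; field_simp

lemma comp_degree_lt {p q : ℝ[X]} {m : ℕ} (hp : p.degree < m) (hq : q.natDegree ≤ 1) :
    (p.comp q).degree < m := by
  rcases eq_or_ne p 0 with rfl | h0
  · simp
  · have h1 := (natDegree_lt_iff_degree_lt h0).mpr hp
    refine lt_of_le_of_lt degree_le_natDegree ?_
    have : (p.comp q).natDegree ≤ p.natDegree := by
      rw [natDegree_comp]; nlinarith
    exact_mod_cast lt_of_le_of_lt this h1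

lemma Lc_orth {a b : ℝ} (hab : a < b) (m : ℕ) (q : ℝ[X]) (hq : q.degree < m) :
    pI a b (Lc a b m * q) = 0 := by
  rw [pI_scale hab, mul_comp, Lc_comp hab, leg_orth m _ (comp_degree_lt hq (phi_natDegree a b)),
    mul_zero]

lemma Lc_norm {a b : ℝ} (hab : a < b) (m : ℕ) :
    pI a b (Lc a b m * Lc a b m) = (b - a) / (2 * m + 1) := by
  rw [pI_scale hab, mul_comp, Lc_comp hab, leg_norm]
  have hm : (2 * (m:ℝ) + 1) ≠ 0 := by positivity
  field_simp

lemma Lc_eval_right {a b : ℝ} (hab : a < b) (m : ℕ) : (Lc a b m).eval b = 1 := by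
  have : b - a ≠ 0 := by linarith
  rw [Lc, eval_comp]
  have : (psiP a b).eval b = 1 := by simp [psiP]; field_simp; ring
  rw [this, legPoly_one]

lemma Lc_natDegree_le (a b : ℝ) (m : ℕ) : (Lc a b m).natDegree ≤ m := by
  rw [Lc, natDegree_comp]
  have := legPoly_natDegree_le m
  have := psi_natDegree a b
  nlinarith

lemma Lc_coeff_ne {a b : ℝ} (hab : a < b) (m : ℕ) : (Lc a b m).coeff m ≠ 0 := by
  intro h
  have hd : (Lc a b m).degree < m := by
    rw [degree_lt_iff_coeff_zero]
    intro i hi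
    rcases Nat.lt_or_ge m i with h' | h'
    · exact coeff_eq_zero_of_natDegree_lt (lt_of_le_of_lt (Lc_natDegree_le a b m) h')
    · rw [show i = m by omega]; exact h
  have := Lc_orth hab m _ hd
  rw [Lc_norm hab] at this
  have : 0 < (b - a) / (2 * m + 1) := div_pos (by linarith) (by positivity)
  linarith

lemma Lc_decomp {a b : ℝ} (hab : a < b) (m : ℕ) (v : ℝ[X]) (hv : v.degree < (m + 1 : ℕ)) :
    ∃ (α : ℝ) (r : ℝ[X]), v = C α * Lc a b m + r ∧ r.degree < m := by
  refine ⟨v.coeff m / (Lc a b m).coeff m, v - C (v.coeff m / (Lc a b m).coeff m) * Lc a b m,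
    by ring, ?_⟩
  rw [degree_lt_iff_coeff_zero] at hv ⊢
  intro i hi
  rw [coeff_sub, coeff_C_mul]
  rcases Nat.lt_or_ge m i with h' | h'
  · rw [coeff_eq_zero_of_natDegree_lt (lt_of_le_of_lt (Lc_natDegree_le a b m) h'), hv i (by omega)]
    simp
  · rw [show i = m by omega, div_mul_cancel₀ _ (Lc_coeff_ne hab m), sub_self]

lemma Lc_expand {a b : ℝ} (hab : a < b) (n : ℕ) (v : ℝ[X]) (hv : v.degree < n) :
    v = ∑ m ∈ Finset.range n, C ((2 * (m:ℝ) + 1) / (b - a) * pI a b (v * Lc a b m)) * Lc a b m := by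
  induction n generalizing v with
  | zero =>
    have : v = 0 := by
      rw [← degree_eq_bot]; simpa using hv
    simp [this]
  | succ n ih =>
    obtain ⟨α, r, hr, hd⟩ := Lc_decomp hab n v hv
    have hb : b - a ≠ 0 := by linarith
    have h1 : pI a b (v * Lc a b n) = α * ((b - a) / (2 * n + 1)) := by
      rw [hr, add_mul, map_add, mul_assoc, pI_C_mul, Lc_norm hab, mul_comm r, Lc_orth hab n r hd,
        add_zero]
    have h2 : ∀ m ∈ Finset.range n, pI a b (v * Lc a b m) = pI a b (r * Lc a b m) := by
      intro m hm
      rw [hr, add_mul, map_add, mul_assoc, pI_C_mul, Lc_orth hab n (Lc a b m), mul_zero, zero_add]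
      refine lt_of_le_of_lt degree_le_natDegree ?_
      exact_mod_cast lt_of_le_of_lt (Lc_natDegree_le a b m) (Finset.mem_range.mp hm)
    rw [Finset.sum_range_succ, h1, Finset.sum_congr rfl (fun m hm => by rw [h2 m hm]), ← ih r hd]
    have : (2 * (n:ℝ) + 1) / (b - a) * (α * ((b - a) / (2 * n + 1))) = α := by
      have hm : (2 * (n:ℝ) + 1) ≠ 0 := by positivity
      field_simp
    rw [this, add_comm, ← hr]

/-- reproducing kernel at `b`. -/
noncomputable def Kp (a b : ℝ) (n : ℕ) : ℝ[X] :=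
  ∑ l ∈ Finset.range n, C (2 * (l:ℝ) + 1) * Lc a b l

lemma radauCoeff_eq {a b : ℝ} (hab : a < b) (w : ℝ → ℝ) (m : ℕ) :
    radauCoeff a b w m = w b - (1 / (b - a)) * ∫ x in a..b, w x * (Kp a b m).eval x := by
  unfold radauCoeff Kp
  simp only [legendreCell_eq hab, eval_finsetSum, eval_mul, eval_C]

lemma Kp_repro {a b : ℝ} (hab : a < b) (n : ℕ) (v : ℝ[X]) (hv : v.degree < n) :
    pI a b (v * Kp a b n) = (b - a) * v.eval b := by
  have hb : b - a ≠ 0 := by linarith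
  conv_rhs => rw [Lc_expand hab n v hv]
  rw [eval_finsetSum, Kp, Finset.mul_sum, Finset.mul_sum, map_sum]
  refine Finset.sum_congr rfl (fun m _ => ?_)
  rw [show v * (C (2 * (m:ℝ) + 1) * Lc a b m) = C (2 * (m:ℝ) + 1) * (v * Lc a b m) by ring, pI_C_mul]
  rw [eval_mul, eval_C, Lc_eval_right hab]
  field_simp

lemma radau_poly {a b : ℝ} (hab : a < b) (n : ℕ) (v : ℝ[X]) (hv : v.degree < n) :
    radauCoeff a b (fun x => v.eval x) n = 0 := by
  have hb : b - a ≠ 0 := by linarith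
  have := Kp_repro hab n v hv
  rw [pI_apply] at this
  simp only [eval_mul] at this
  rw [radauCoeff_eq hab, this]
  field_simp; ring

lemma degree_lt_of_natDegree_le {v : ℝ[X]} {k : ℕ} (h : v.natDegree ≤ k) :
    v.degree < (k + 1 : ℕ) :=
  lt_of_le_of_lt degree_le_natDegree (by exact_mod_cast Nat.lt_succ_of_le h)

/-- key identity for the Gauss–Radau projection. -/
lemma GR_key {a b : ℝ} (hab : a < b) {k : ℕ} (hk : 1 ≤ k) {u : ℝ → ℝ} (hu : Continuous u)
    {P : ℝ[X]} (hP : IsGRProj k a b u P) (v : ℝ[X]) (hv : v.natDegree ≤ k) :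
    pI a b (P * v) = (∫ x in a..b, u x * v.eval x)
      + radauCoeff a b u (k + 1) * pI a b (Lc a b k * v) := by
  have hb : b - a ≠ 0 := by linarith
  obtain ⟨h1, h2, h3⟩ := hP
  -- functional
  set J : ℝ[X] → ℝ := fun v => pI a b (P * v) - ∫ x in a..b, u x * v.eval x with hJ
  have hint : ∀ v : ℝ[X], IntervalIntegrable (fun x => u x * v.eval x) volume a b :=
    fun v => (hu.mul v.continuous).intervalIntegrable _ _
  have hJadd : ∀ v w, J (v + w) = J v + J w := by
    intro v w
    simp only [hJ, mul_add, map_add, eval_add]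
    rw [intervalIntegral.integral_add (hint v) (hint w)]; ring
  have hJmul : ∀ c v, J (C c * v) = c * J v := by
    intro c v
    simp only [hJ]
    rw [show P * (C c * v) = C c * (P * v) by ring, pI_C_mul]
    simp only [eval_mul, eval_C]
    rw [show (fun x => u x * (c * eval x v)) = fun x => c * (u x * eval x v) by funext x; ring,
      intervalIntegral.integral_const_mul]; ring
  have hJlow : ∀ v : ℝ[X], v.degree < k → J v = 0 := by
    intro v hv
    have : v.natDegree + 1 ≤ k := by
      rcases eq_or_ne v 0 with rfl | h0
      · simpa using hk
      · exact (natDegree_lt_iff_degree_lt h0).mpr hv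
    have := h2 v this
    simp only [hJ, pI_apply, eval_mul]
    linarith
  have hKk : J (Kp a b (k + 1)) = (2 * (k:ℝ) + 1) * J (Lc a b k) := by
    have hK : Kp a b (k + 1) = Kp a b k + C (2 * (k:ℝ) + 1) * Lc a b k := by
      unfold Kp; rw [Finset.sum_range_succ]
    rw [hK, hJadd, hJmul, hJlow (Kp a b k), zero_add]
    unfold Kp
    rw [degree_lt_iff_coeff_zero]
    intro i hi
    rw [finsetSum_coeff]
    refine Finset.sum_eq_zero (fun m hm => ?_)
    rw [coeff_C_mul, coeff_eq_zero_of_natDegree_lt, mul_zero]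
    exact lt_of_le_of_lt (Lc_natDegree_le a b m) (lt_of_lt_of_le (Finset.mem_range.mp hm) hi)
  have hrad : J (Kp a b (k + 1)) = (b - a) * radauCoeff a b u (k + 1) := by
    simp only [hJ]
    rw [radauCoeff_eq hab, Kp_repro hab (k+1) P (degree_lt_of_natDegree_le h1), h3]
    field_simp
  obtain ⟨α, r, hr, hd⟩ := Lc_decomp hab k v (degree_lt_of_natDegree_le hv)
  have e1 : J v = α * J (Lc a b k) := by
    rw [hr, hJadd, hJmul, hJlow r hd, add_zero]
  have e2 : pI a b (Lc a b k * v) = α * ((b - a) / (2 * k + 1)) := by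
    rw [hr, mul_add, map_add, mul_left_comm, pI_C_mul, Lc_norm hab, Lc_orth hab k r hd, add_zero]
  have e3 : J v = radauCoeff a b u (k + 1) * pI a b (Lc a b k * v) := by
    rw [e1, e2]
    have hm : (2 * (k:ℝ) + 1) ≠ 0 := by positivity
    rw [hKk] at hrad
    field_simp
    linear_combination α * hrad
  have : pI a b (P * v) = J v + ∫ x in a..b, u x * v.eval x := by simp only [hJ]; ring
  rw [this, e3]; ring

lemma GR_unique {a b : ℝ} (hab : a < b) {k : ℕ} (hk : 1 ≤ k) {u : ℝ → ℝ}
    {P Q : ℝ[X]} (hP : IsGRProj k a b u P) (hQ : IsGRProj k a b u Q) : P = Q := by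
  have hd : (X - C b) ∣ (P - Q) := by
    rw [dvd_iff_isRoot, IsRoot, eval_sub, hP.2.2, hQ.2.2, sub_self]
  obtain ⟨q, hq⟩ := hd
  rcases eq_or_ne q 0 with rfl | hq0
  · rw [mul_zero] at hq; exact sub_eq_zero.mp hq
  exfalso
  have hdeg : (P - Q).natDegree ≤ k := (natDegree_sub_le_of_le hP.1 hQ.1).trans (by simp)
  rw [hq, natDegree_mul (X_sub_C_ne_zero b) hq0, natDegree_X_sub_C] at hdeg
  have hv : q.natDegree + 1 ≤ k := by omega
  have h0 : pI a b ((P - Q) * q) = 0 := by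
    have := (hP.2.1 q hv).trans (hQ.2.1 q hv).symm
    rw [sub_mul, map_sub, pI_apply, pI_apply]
    simp only [eval_mul]; linarith
  rw [hq] at h0
  have h1 : pI a b ((C b - X) * q * q) = 0 := by
    rw [show (C b - X) * q * q = -((X - C b) * q * q) by ring, map_neg, h0, neg_zero]
  have := poly_zero_of_integral hab _ (fun x hx => by
    simp only [eval_mul, eval_sub, eval_C, eval_X]
    rw [mul_assoc]
    exact mul_nonneg (by linarith [hx.2]) (mul_self_nonneg _)) h1
  rw [mul_assoc] at this
  rcases mul_eq_zero.mp this with h | h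
  · have := congrArg (fun p => eval (b+1) p) h
    simp at this
  · exact hq0 (mul_self_eq_zero.mp h)

/-! ### The correction polynomials -/

/-- antiderivative vanishing at `b`. -/
lemma exists_antideriv (v : ℝ[X]) (b : ℝ) :
    ∃ V : ℝ[X], derivative V = v ∧ V.eval b = 0 ∧ V.natDegree ≤ v.natDegree + 1 := by
  have : ∃ V : ℝ[X], derivative V = v ∧ V.natDegree ≤ v.natDegree + 1 := by
    refine ⟨∑ i ∈ Finset.range (v.natDegree + 1), C (v.coeff i / (i + 1)) * X ^ (i + 1), ?_, ?_⟩
    · rw [derivative_sum]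
      conv_rhs => rw [v.as_sum_range_C_mul_X_pow]
      refine Finset.sum_congr rfl (fun i _ => ?_)
      rw [derivative_C_mul_X_pow]
      have : ((i:ℝ) + 1) ≠ 0 := by positivity
      push_cast
      rw [div_mul_cancel₀ _ this]
      try simp
    · refine natDegree_sum_le_of_forall_le _ _ (fun i hi => ?_)
      refine (natDegree_C_mul_X_pow_le _ _).trans ?_
      have := Finset.mem_range.mp hi; omega
  obtain ⟨V, h1, h2⟩ := this
  refine ⟨V - C (V.eval b), by simp [h1], by simp, ?_⟩
  exact (natDegree_sub_le_of_le h2 (by simp : (C (V.eval b)).natDegree ≤ v.natDegree + 1)).trans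
    (by simp)

lemma Dinv_ibp {a b : ℝ} (p V : ℝ[X]) :
    ∫ x in a..b, Dinv a b (fun y => p.eval y) x * (derivative V).eval x
      = 2 / (b - a) * (pI a b p * V.eval b) - 2 / (b - a) * pI a b (p * V) := by
  have hD : ∀ x, HasDerivAt (Dinv a b (fun y => p.eval y)) (2 / (b - a) * p.eval x) x := by
    intro x
    unfold Dinv
    apply HasDerivAt.const_mul
    exact p.continuous.integral_hasStrictDerivAt a x |>.hasDerivAt
  have := intervalIntegral.integral_mul_deriv_eq_deriv_mul (a := a) (b := b)
    (fun x _ => hD x) (fun x _ => V.hasDerivAt x)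
    ((continuous_const.mul p.continuous).intervalIntegrable _ _)
    ((derivative V).continuous.intervalIntegrable _ _)
  rw [this]
  have ha : Dinv a b (fun y => p.eval y) a = 0 := by simp [Dinv]
  rw [ha, pI_apply, pI_apply]
  simp only [eval_mul, mul_assoc]
  rw [intervalIntegral.integral_const_mul]
  simp [Dinv, mul_assoc]

lemma cell_fun_eq {a b : ℝ} (hab : a < b) (k : ℕ) :
    legendreCell k a b = fun x => (Lc a b k).eval x := by
  funext x; exact legendreCell_eq hab k x

lemma F_orth {a b : ℝ} (hab : a < b) {k : ℕ} {F : ℕ → ℝ[X]} (hF : IsFSeq k a b F)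
    (i : ℕ) (hi : 1 ≤ i) (v : ℝ[X]) (hv : v.natDegree + 1 + i ≤ k) : pI a b (F i * v) = 0 := by
  induction i, hi using Nat.le_induction generalizing v with
  | base =>
    obtain ⟨V, h1, h2, h3⟩ := exists_antideriv v b
    have := hF.1.2.1 v (by omega)
    rw [pI_apply]
    simp only [eval_mul]
    rw [this, cell_fun_eq hab, ← h1, Dinv_ibp, h2, Lc_orth hab k V]
    · simp
    · exact lt_of_lt_of_le (degree_lt_of_natDegree_le h3) (by exact_mod_cast hv)
  | succ i hi ih =>
    obtain ⟨V, h1, h2, h3⟩ := exists_antideriv v b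
    have := (hF.2 (i+1) (by omega)).2.1 v (by omega)
    rw [Nat.add_sub_cancel, ← h1, Dinv_ibp, h2, ih V (by omega)] at this
    rw [h1] at this
    rw [← neg_eq_zero, ← map_neg, ← neg_mul, pI_apply]
    simp only [eval_mul]
    rw [this]; simp

lemma F_right {a b : ℝ} (hab : a < b) {k : ℕ} (hk : 1 ≤ k) {F : ℕ → ℝ[X]} (hF : IsFSeq k a b F)
    (i : ℕ) (hi : 1 ≤ i) (hik : i ≤ k) : (F i).eval b = 0 := by
  rcases Nat.lt_or_ge 1 i with h | h
  · have := (hF.2 i h).2.2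
    have h0 := F_orth hab hF (i-1) (by omega) 1 (by simp; omega)
    rw [mul_one, pI_apply] at h0
    rw [eval_neg, Dinv, h0, mul_zero] at this
    linarith
  · have : i = 1 := by omega
    subst this
    rw [hF.1.2.2, Dinv, cell_fun_eq hab]
    have h0 := Lc_orth hab k 1 (by rw [degree_one]; exact_mod_cast hk)
    rw [mul_one, pI_apply] at h0
    rw [h0, mul_zero]

lemma F_one_ibp {a b : ℝ} (hab : a < b) {k : ℕ} (hk : 1 ≤ k) {F : ℕ → ℝ[X]} (hF : IsFSeq k a b F)
    (v : ℝ[X]) (hv : v.natDegree ≤ k) :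
    pI a b (F 1 * derivative v) = - (2 / (b - a)) * pI a b (Lc a b k * v) := by
  have hd := natDegree_derivative_le v
  have := hF.1.2.1 (derivative v) (by omega)
  rw [cell_fun_eq hab, Dinv_ibp] at this
  rw [pI_apply]; simp only [eval_mul]; rw [this]
  have h0 := Lc_orth hab k 1 (by rw [degree_one]; exact_mod_cast hk)
  rw [mul_one] at h0
  rw [h0]; ring

lemma F_succ_ibp {a b : ℝ} (hab : a < b) {k : ℕ} (hk : 1 ≤ k) {F : ℕ → ℝ[X]} (hF : IsFSeq k a b F)
    (i : ℕ) (hi : 1 ≤ i) (hik : i + 1 ≤ k) (v : ℝ[X]) (hv : v.natDegree ≤ k) :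
    pI a b (F (i + 1) * derivative v) = (2 / (b - a)) * pI a b (F i * v) := by
  have hd := natDegree_derivative_le v
  have := (hF.2 (i+1) (by omega)).2.1 (derivative v) (by omega)
  rw [Nat.add_sub_cancel, Dinv_ibp] at this
  have h0 := F_orth hab hF i hi 1 (by simp; omega)
  rw [mul_one] at h0
  rw [h0] at this
  have h2 : pI a b (-F (i+1) * derivative v) = - (2 / (b - a)) * pI a b (F i * v) := by
    rw [pI_apply]; simp only [eval_mul]; rw [this]; ring
  rw [neg_mul, map_neg] at h2
  linarith

lemma F_natDegree {a b : ℝ} {k : ℕ} {F : ℕ → ℝ[X]} (hF : IsFSeq k a b F)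
    (i : ℕ) (hi : 1 ≤ i) : (F i).natDegree ≤ k := by
  rcases Nat.lt_or_ge 1 i with h | h
  · have := (hF.2 i h).1
    rwa [natDegree_neg] at this
  · have : i = 1 := by omega
    subst this
    exact hF.1.1

/-! ### Scaling of correction polynomials -/

lemma GR_scale {a b : ℝ} (hab : a < b) {k : ℕ} {u : ℝ → ℝ} {P : ℝ[X]} (hP : IsGRProj k a b u P) :
    IsGRProj k (-1) 1 (fun s => u ((b - a) / 2 * s + (a + b) / 2)) (P.comp (phiP a b)) := by
  have hb : (b - a) / 2 ≠ 0 := by have : 0 < b - a := by linarith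
                                  positivity
  refine ⟨?_, ?_, ?_⟩
  · rw [natDegree_comp]
    have := phi_natDegree a b
    have := hP.1
    nlinarith
  · intro v hv
    have h1 : (v.comp (psiP a b)).natDegree + 1 ≤ k := by
      rw [natDegree_comp]
      have := psi_natDegree a b
      nlinarith
    have h2 := hP.2.1 _ h1
    rw [int_scale hab, int_scale hab (fun x => u x * _)] at h2
    have h3 := mul_left_cancel₀ hb h2
    have h4 : ∀ s, eval ((b - a) / 2 * s + (a + b) / 2) (v.comp (psiP a b)) = eval s v := by
      intro s
      rw [← phi_eval, ← eval_comp, comp_assoc, psi_phi hab, comp_X]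
    simp only [h4] at h3
    simp only [eval_comp, phi_eval]
    exact h3
  · rw [eval_comp, phi_eval]
    have : (b - a) / 2 * 1 + (a + b) / 2 = b := by ring
    rw [this, hP.2.2]
    simp only [this]

lemma Dinv_scale {a b : ℝ} (hab : a < b) (v : ℝ → ℝ) (s : ℝ) :
    Dinv a b v ((b - a) / 2 * s + (a + b) / 2)
      = Dinv (-1) 1 (fun s => v ((b - a) / 2 * s + (a + b) / 2)) s := by
  have hb : (b - a) / 2 ≠ 0 := by have : 0 < b - a := by linarith
                                  positivity
  unfold Dinv
  rw [intervalIntegral.integral_comp_mul_add (fun x => v x) hb, smul_eq_mul]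
  have : (b - a) / 2 * -1 + (a + b) / 2 = a := by ring
  rw [this, ← mul_assoc]
  congr 1
  have : b - a ≠ 0 := by linarith
  field_simp; norm_num

lemma FSeq_scale {a b : ℝ} (hab : a < b) {k : ℕ} {F : ℕ → ℝ[X]} (hF : IsFSeq k a b F) :
    IsFSeq k (-1) 1 (fun i => (F i).comp (phiP a b)) := by
  have hb : b - a ≠ 0 := by linarith
  refine ⟨?_, ?_⟩
  · have := GR_scale hab hF.1
    simp only [Dinv_scale hab] at this
    convert this using 3
    unfold legendreCell
    congr 1
    field_simp; ring
  · intro i hi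
    have := GR_scale hab (hF.2 i hi)
    simp only [Dinv_scale hab] at this
    rw [neg_comp] at this
    simpa only [eval_comp, phi_eval] using this

lemma FSeq_unique {a b : ℝ} (hab : a < b) {k : ℕ} (hk : 1 ≤ k) {F F' : ℕ → ℝ[X]}
    (hF : IsFSeq k a b F) (hF' : IsFSeq k a b F') (i : ℕ) (hi : 1 ≤ i) : F i = F' i := by
  induction i, hi using Nat.le_induction with
  | base => exact GR_unique hab hk hF.1 hF'.1
  | succ i hi ih =>
    have h1 := hF.2 (i+1) (by omega)
    have h2 := hF'.2 (i+1) (by omega)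
    rw [Nat.add_sub_cancel] at h1 h2
    rw [ih] at h1
    exact neg_injective (GR_unique hab hk h1 h2)

lemma F_bound (k l : ℕ) (hk : 1 ≤ k) (hl : 1 ≤ l) : ∃ Cf : ℝ, 0 ≤ Cf ∧ ∀ a b : ℝ, a < b →
    ∀ F : ℕ → ℝ[X], IsFSeq k a b F → pI a b (F l * F l) ≤ Cf * (b - a) := by
  by_cases hex : ∃ F0 : ℕ → ℝ[X], IsFSeq k (-1) 1 F0
  · obtain ⟨F0, hF0⟩ := hex
    refine ⟨pI (-1) 1 (F0 l * F0 l) / 2,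
      div_nonneg (pI_sq_nonneg (by norm_num) _) (by norm_num), ?_⟩
    intro a b hab F hF
    have := FSeq_unique (by norm_num) hk (FSeq_scale hab hF) hF0 l hl
    rw [pI_scale hab, mul_comp, this]
    apply le_of_eq; ring
  · refine ⟨0, le_rfl, ?_⟩
    intro a b hab F hF
    exact absurd ⟨_, FSeq_scale hab hF⟩ hex


/-! ### Differentiation in time -/

lemma hasDeriv_int_shift {f : ℝ → ℝ} (hf : ContDiff ℝ 1 f) {g : ℝ → ℝ} (hg : Continuous g)
    (a b t : ℝ) :
    HasDerivAt (fun s => ∫ x in a..b, f (x - s) * g x)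
      (∫ x in a..b, -(deriv f (x - t)) * g x) t := by
  have hf' : Continuous (deriv f) := hf.continuous_deriv le_rfl
  have hfc : Continuous f := hf.continuous
  have hcont : Continuous (fun z : ℝ × ℝ => -(deriv f (z.1 - z.2)) * g z.1) := by fun_prop
  have hcpt : IsCompact (Set.uIcc a b ×ˢ Metric.closedBall t 1) :=
    isCompact_uIcc.prod (isCompact_closedBall t 1)
  obtain ⟨B, hB⟩ := hcpt.exists_bound_of_continuousOn hcont.continuousOn
  refine (intervalIntegral.hasDerivAt_integral_of_dominated_loc_of_deriv_le
    (F := fun s x => f (x - s) * g x) (F' := fun s x => -(deriv f (x - s)) * g x)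
    (bound := fun _ => B) (Metric.closedBall_mem_nhds t one_pos) ?_ ?_ ?_ ?_ ?_ ?_).2
  · refine Filter.Eventually.of_forall (fun s => ?_)
    exact (by fun_prop : Continuous (fun x => f (x - s) * g x)).aestronglyMeasurable
  · exact (by fun_prop : Continuous (fun x => f (x - t) * g x)).intervalIntegrable _ _
  · exact (by fun_prop : Continuous (fun x => -(deriv f (x - t)) * g x)).aestronglyMeasurable
  · refine Filter.Eventually.of_forall (fun x hx s hs => ?_)
    exact hB (x, s) ⟨Set.uIoc_subset_uIcc hx, hs⟩
  · exact intervalIntegrable_const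
  · refine Filter.Eventually.of_forall (fun x hx s hs => ?_)
    have h1 : HasDerivAt f (deriv f (x - s)) (x - s) :=
      (hf.differentiable one_ne_zero).differentiableAt.hasDerivAt
    have h2 : HasDerivAt (fun s => x - s) (-1) s := by
      simpa using (hasDerivAt_id s).const_sub x
    have h3 := (h1.comp s h2).mul_const (g x)
    exact h3.congr_deriv (by ring)

lemma radau_deriv {a b : ℝ} (hab : a < b) {f : ℝ → ℝ} (hf : ContDiff ℝ 1 f) (n : ℕ) (t : ℝ) :
    HasDerivAt (fun s => radauCoeff a b (fun y => f (y - s)) n)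
      (-(radauCoeff a b (fun y => deriv f (y - t)) n)) t := by
  simp only [radauCoeff_eq hab]
  have h1 : HasDerivAt (fun s => f (b - s)) (-(deriv f (b - t))) t := by
    have h1 : HasDerivAt f (deriv f (b - t)) (b - t) :=
      (hf.differentiable one_ne_zero).differentiableAt.hasDerivAt
    have h2 : HasDerivAt (fun s => b - s) (-1) t := by
      simpa using (hasDerivAt_id t).const_sub b
    have h3 := h1.comp t h2
    exact h3.congr_deriv (by ring)
  have h2 := (hasDeriv_int_shift hf (Kp a b n).continuous a b t).const_mul (1 / (b - a))
  refine (h1.sub h2).congr_deriv ?_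
  simp only [neg_mul, intervalIntegral.integral_neg]
  ring

lemma contDiff_iter {u0 : ℝ → ℝ} {n : ℕ} (hu : ContDiff ℝ n u0) (i m : ℕ) (him : i + m ≤ n) :
    ContDiff ℝ m (iteratedDeriv i u0) := by
  rw [iteratedDeriv_eq_iterate]
  apply ContDiff.iterate_deriv' m i
  exact hu.of_le (by exact_mod_cast (by omega : m + i ≤ n))

lemma Gfun_eq {a b : ℝ} (hab : a < b) (k : ℕ) {u0 : ℝ → ℝ} {n : ℕ} (hu : ContDiff ℝ n u0)
    (i : ℕ) (hi : i ≤ n) :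
    Gfun k a b u0 i = fun t => (-1) ^ i * radauCoeff a b (fun y => iteratedDeriv i u0 (y - t)) (k + 1) := by
  unfold Gfun
  induction i with
  | zero => funext t; simp
  | succ i ih =>
    funext t
    rw [iteratedDeriv_succ, show iteratedDeriv i (fun s => radauCoeff a b (fun y => u0 (y - s)) (k + 1))
      = _ from ih (by omega)]
    have h1 : ContDiff ℝ 1 (iteratedDeriv i u0) := by
      exact_mod_cast contDiff_iter hu i 1 (by omega)
    have := (radau_deriv hab h1 (k+1) t).const_mul ((-1) ^ i)
    rw [this.deriv, iteratedDeriv_succ, pow_succ]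
    ring

lemma Gfun_deriv {a b : ℝ} (hab : a < b) (k : ℕ) {u0 : ℝ → ℝ} {n : ℕ} (hu : ContDiff ℝ n u0)
    (i : ℕ) (hi : i + 1 ≤ n) (t : ℝ) :
    HasDerivAt (Gfun k a b u0 i) (Gfun k a b u0 (i + 1) t) t := by
  rw [Gfun_eq hab k hu i (by omega), Gfun_eq hab k hu (i+1) hi]
  have h1 : ContDiff ℝ 1 (iteratedDeriv i u0) := by
    exact_mod_cast contDiff_iter hu i 1 (by omega)
  have := (radau_deriv hab h1 (k+1) t).const_mul ((-1) ^ i)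
  refine this.congr_deriv ?_
  simp only [iteratedDeriv_succ, pow_succ]
  ring

/-! ### Bound for the Radau coefficients -/

lemma antideriv_degree {V v : ℝ[X]} (h : derivative V = v) {n : ℕ} (hv : v.degree < n) :
    V.degree < (n + 1 : ℕ) := by
  rw [degree_lt_iff_coeff_zero] at hv ⊢
  intro i hi
  obtain ⟨i, rfl⟩ : ∃ i', i = i' + 1 := ⟨i - 1, by omega⟩
  have := hv i (by omega)
  rw [← h, coeff_derivative] at this
  have h2 : ((i:ℝ) + 1) ≠ 0 := by positivity
  exact (mul_eq_zero.mp this).resolve_right h2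

lemma poly_approx {a b : ℝ} (hab : a < b) (n : ℕ) (f : ℝ → ℝ) (hf : ContDiff ℝ n f) (M : ℝ)
    (hM : ∀ y ∈ Set.Icc a b, |iteratedDeriv n f y| ≤ M) :
    ∃ p : ℝ[X], p.degree < n ∧ ∀ y ∈ Set.Icc a b, |f y - p.eval y| ≤ M * (b - a) ^ n := by
  induction n generalizing f with
  | zero => exact ⟨0, by simp, fun y hy => by simpa using hM y hy⟩
  | succ n ih =>
    have hf1 : ContDiff ℝ n (deriv f) := by
      have : ContDiff ℝ ((n:WithTop ℕ∞) + 1) f := by exact_mod_cast hf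
      exact (contDiff_succ_iff_deriv.mp this).2.2
    obtain ⟨q, hq1, hq2⟩ := ih (deriv f) hf1 (fun y hy => by
      have := hM y hy
      rwa [iteratedDeriv_succ'] at this)
    obtain ⟨V, h1, h2, -⟩ := exists_antideriv q a
    refine ⟨V + C (f a), ?_, ?_⟩
    · exact antideriv_degree (by simp [h1]) hq1
    · intro y hy
      have hd : ∀ x ∈ Set.Icc a b, HasDerivWithinAt (fun x => f x - (V + C (f a)).eval x)
          (deriv f x - q.eval x) (Set.Icc a b) x := by
        intro x _
        have e1 : HasDerivAt f (deriv f x) x :=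
          (hf.differentiable (by simp)).differentiableAt.hasDerivAt
        have e2 : HasDerivAt (fun x => (V + C (f a)).eval x) (q.eval x) x := by
          have := (V + C (f a)).hasDerivAt x
          simpa [h1] using this
        exact (e1.sub e2).hasDerivWithinAt
      have := (convex_Icc a b).norm_image_sub_le_of_norm_hasDerivWithin_le hd
        (fun x hx => hq2 x hx) (Set.left_mem_Icc.mpr hab.le) hy
      simp only [eval_add, eval_C, h2, zero_add, sub_self, sub_zero, Real.norm_eq_abs] at this
      rw [eval_add, eval_C]
      refine this.trans ?_
      rw [pow_succ, ← mul_assoc]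
      have h0 : 0 ≤ M * (b - a) ^ n := (abs_nonneg _).trans (hq2 y hy)
      apply mul_le_mul_of_nonneg_left _ h0
      rw [abs_of_nonneg (by linarith [hy.1])]
      linarith [hy.2]

lemma K_bound (n : ℕ) : ∃ KB : ℝ, 0 ≤ KB ∧ ∀ a b : ℝ, a < b → ∀ x ∈ Set.Icc a b,
    |(Kp a b n).eval x| ≤ KB := by
  set R : ℝ[X] := ∑ l ∈ Finset.range n, C (2 * (l:ℝ) + 1) * legPoly l with hR
  obtain ⟨B, hB⟩ := (isCompact_Icc (a := (-1:ℝ)) (b := 1)).exists_bound_of_continuousOn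
    R.continuous.continuousOn
  refine ⟨B, (norm_nonneg _).trans (hB 0 (by norm_num)), ?_⟩
  intro a b hab x hx
  have hb : 0 < b - a := by linarith
  have : Kp a b n = R.comp (psiP a b) := by
    rw [hR, Polynomial.sum_comp]
    unfold Kp
    refine Finset.sum_congr rfl (fun l _ => ?_)
    rw [mul_comp, C_comp, Lc]
  rw [this, eval_comp]
  apply hB
  have e : (psiP a b).eval x = (2 * x - (a + b)) / (b - a) := by
    simp [psiP]; field_simp
  rw [e, Set.mem_Icc, le_div_iff₀ hb, div_le_iff₀ hb]
  constructor <;> nlinarith [hx.1, hx.2]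

lemma radau_sup {a b : ℝ} (hab : a < b) {n : ℕ} {KB : ℝ}
    (hK : ∀ x ∈ Set.Icc a b, |(Kp a b n).eval x| ≤ KB) {w : ℝ → ℝ} {B : ℝ}
    (hw : ∀ x ∈ Set.Icc a b, |w x| ≤ B) : |radauCoeff a b w n| ≤ (1 + KB) * B := by
  have hb : 0 < b - a := by linarith
  have hB : 0 ≤ B := (abs_nonneg _).trans (hw a (Set.left_mem_Icc.mpr hab.le))
  rw [radauCoeff_eq hab]
  have h1 : |∫ x in a..b, w x * (Kp a b n).eval x| ≤ (B * KB) * (b - a) := by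
    have := intervalIntegral.norm_integral_le_of_norm_le_const (a := a) (b := b)
      (f := fun x => w x * (Kp a b n).eval x) (C := B * KB) (fun x hx => by
        rw [Set.uIoc_of_le hab.le] at hx
        have hx' : x ∈ Set.Icc a b := ⟨hx.1.le, hx.2⟩
        rw [Real.norm_eq_abs, abs_mul]
        exact mul_le_mul (hw x hx') (hK x hx') (abs_nonneg _) hB)
    rwa [abs_of_pos hb] at this
  have h2 : |1 / (b - a) * ∫ x in a..b, w x * (Kp a b n).eval x| ≤ B * KB := by
    rw [abs_mul, abs_of_pos (by positivity : 0 < 1 / (b - a))]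
    rw [one_div, inv_mul_le_iff₀ hb]
    linarith
  refine (abs_sub _ _).trans ?_
  have := hw b (Set.right_mem_Icc.mpr hab.le)
  linarith

lemma radau_sub_poly {a b : ℝ} (hab : a < b) {n : ℕ} {w : ℝ → ℝ} (hw : Continuous w) (p : ℝ[X])
    (hp : p.degree < n) :
    radauCoeff a b w n = radauCoeff a b (fun x => w x - p.eval x) n := by
  have h0 := radau_poly hab n p hp
  rw [radauCoeff_eq hab] at h0 ⊢
  rw [radauCoeff_eq hab]
  have : (∫ x in a..b, (w x - p.eval x) * (Kp a b n).eval x)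
      = (∫ x in a..b, w x * (Kp a b n).eval x) - ∫ x in a..b, p.eval x * (Kp a b n).eval x := by
    rw [← intervalIntegral.integral_sub ((by fun_prop : Continuous
      (fun x => w x * (Kp a b n).eval x)).intervalIntegrable _ _)
      ((by fun_prop : Continuous (fun x => p.eval x * (Kp a b n).eval x)).intervalIntegrable _ _)]
    congr 1; funext x; ring
  rw [this]
  linarith

lemma G_bound (k l : ℕ) : ∃ Kg : ℝ, 0 ≤ Kg ∧ ∀ a b : ℝ, a < b → ∀ u0 : ℝ → ℝ,
    ContDiff ℝ (k + l + 2 : ℕ) u0 → ∀ M t : ℝ,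
    (∀ y ∈ Set.Icc (a - t) (b - t), |iteratedDeriv (k + l + 2) u0 y| ≤ M) →
    |Gfun k a b u0 (l + 1) t| ≤ Kg * (b - a) ^ (k + 1) * M := by
  obtain ⟨KB, hKB, hK⟩ := K_bound (k + 1)
  refine ⟨1 + KB, by linarith, ?_⟩
  intro a b hab u0 hu M t hM
  rw [Gfun_eq hab k hu (l+1) (by omega)]
  simp only [abs_mul, abs_pow, abs_neg, abs_one, one_pow, one_mul]
  have hg : ContDiff ℝ (k + 1 : ℕ) (iteratedDeriv (l+1) u0) := contDiff_iter hu _ _ (by omega)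
  set g := iteratedDeriv (l+1) u0 with hgdef
  have hab' : a - t < b - t := by linarith
  obtain ⟨p, hp1, hp2⟩ := poly_approx hab' (k+1) g hg M (fun y hy => by
    have := hM y hy
    have e : iteratedDeriv (k + 1) g = iteratedDeriv (k + l + 2) u0 := by
      rw [hgdef]
      simp only [iteratedDeriv_eq_iterate]
      rw [← Function.iterate_add_apply]
      congr 1; omega
    rwa [e])
  have hc : Continuous (fun y => g (y - t)) := hg.continuous.comp (continuous_id.sub continuous_const)
  have hpd : (p.comp (X - C t)).degree < (k + 1 : ℕ) := comp_degree_lt hp1 (by simp)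
  rw [radau_sub_poly hab hc _ hpd]
  refine (radau_sup hab (hK a b hab) (B := M * (b - a) ^ (k + 1)) ?_).trans (le_of_eq (by ring))
  intro x hx
  have := hp2 (x - t) ⟨by linarith [hx.1], by linarith [hx.2]⟩
  rw [show b - t - (a - t) = b - a by ring] at this
  simpa using this


/-! ### Families of polynomials -/

/-- coefficientwise derivative of a family of polynomials. -/
def HasPD (p : ℝ → ℝ[X]) (p' : ℝ[X]) (t : ℝ) : Prop :=
  ∀ i, HasDerivAt (fun s => (p s).coeff i) (p'.coeff i) t

lemma exists_HasPD {k : ℕ} {p : ℝ → ℝ[X]} (hd : ∀ t, (p t).natDegree ≤ k) {t : ℝ}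
    (h : ∀ i, DifferentiableAt ℝ (fun s => (p s).coeff i) t) :
    ∃ p' : ℝ[X], p'.natDegree ≤ k ∧ HasPD p p' t := by
  refine ⟨∑ i ∈ Finset.range (k + 1), C (deriv (fun s => (p s).coeff i) t) * X ^ i, ?_, ?_⟩
  · refine natDegree_sum_le_of_forall_le _ _ (fun i hi => ?_)
    refine (natDegree_C_mul_X_pow_le _ _).trans ?_
    have := Finset.mem_range.mp hi; omega
  · intro i
    have hh := (h i).hasDerivAt
    refine hh.congr_deriv ?_
    rw [finsetSum_coeff]
    simp only [coeff_C_mul, coeff_X_pow]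
    rcases Nat.lt_or_ge i (k+1) with hi | hi
    · simp [hi]
    · have : (fun s => (p s).coeff i) = fun _ => 0 := by
        funext s
        exact coeff_eq_zero_of_natDegree_lt (lt_of_le_of_lt (hd s) (by omega))
      rw [this]
      simp
      intro h; omega

lemma HasPD.sub {p q : ℝ → ℝ[X]} {p' q' : ℝ[X]} {t : ℝ} (hp : HasPD p p' t) (hq : HasPD q q' t) :
    HasPD (fun s => p s - q s) (p' - q') t := by
  intro i
  simp only [coeff_sub]
  exact (hp i).sub (hq i)

lemma HasPD.sum_C_mul {ι : Type*} (S : Finset ι) {g : ι → ℝ → ℝ} {g' : ι → ℝ} {t : ℝ} (f : ι → ℝ[X])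
    (h : ∀ m ∈ S, HasDerivAt (g m) (g' m) t) :
    HasPD (fun s => ∑ m ∈ S, C (g m s) * f m) (∑ m ∈ S, C (g' m) * f m) t := by
  intro i
  simp only [finsetSum_coeff, coeff_C_mul]
  exact HasDerivAt.fun_sum (fun m hm => (h m hm).mul_const _)

lemma pI_expand (a b : ℝ) {k : ℕ} {p : ℝ[X]} (hd : p.natDegree ≤ k) (v : ℝ[X]) :
    pI a b (p * v) = ∑ i ∈ Finset.range (k + 1), p.coeff i * pI a b (X ^ i * v) := by
  conv_lhs => rw [p.as_sum_range_C_mul_X_pow' (n := k + 1) (by omega)]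
  rw [Finset.sum_mul, map_sum]
  refine Finset.sum_congr rfl (fun i _ => ?_)
  rw [mul_assoc, pI_C_mul]

lemma HasPD.pI_mul {k : ℕ} {p : ℝ → ℝ[X]} {p' : ℝ[X]} {t : ℝ} (h : HasPD p p' t)
    (hd : ∀ t, (p t).natDegree ≤ k) (hd' : p'.natDegree ≤ k) (a b : ℝ) (v : ℝ[X]) :
    HasDerivAt (fun s => pI a b (p s * v)) (pI a b (p' * v)) t := by
  simp only [fun s => pI_expand a b (hd s) v]
  rw [pI_expand a b hd' v]
  exact HasDerivAt.fun_sum (fun m _ => (h m).mul_const _)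

lemma HasPD.pI_sq {k : ℕ} {p : ℝ → ℝ[X]} {p' : ℝ[X]} {t : ℝ} (h : HasPD p p' t)
    (hd : ∀ t, (p t).natDegree ≤ k) (hd' : p'.natDegree ≤ k) (a b : ℝ) :
    HasDerivAt (fun s => pI a b (p s * p s)) (2 * pI a b (p' * p t)) t := by
  have e : ∀ s, pI a b (p s * p s)
      = ∑ i ∈ Finset.range (k + 1), (p s).coeff i * pI a b (p s * X ^ i) := by
    intro s; rw [pI_expand a b (hd s)]; simp only [mul_comm]
  simp only [e]
  have := HasDerivAt.fun_sum (u := Finset.range (k + 1))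
    (fun i (_ : i ∈ Finset.range (k + 1)) => (h i).mul (h.pI_mul hd hd' a b (X ^ i)))
  refine this.congr_deriv ?_
  rw [Finset.sum_add_distrib, two_mul]
  congr 1
  · rw [pI_expand a b hd']; simp only [mul_comm]
  · rw [mul_comm p', pI_expand a b (hd t)]; simp only [mul_comm]

lemma HasPD.eval {k : ℕ} {p : ℝ → ℝ[X]} {p' : ℝ[X]} {t : ℝ} (h : HasPD p p' t)
    (hd : ∀ t, (p t).natDegree ≤ k) (hd' : p'.natDegree ≤ k) (y : ℝ) :
    HasDerivAt (fun s => (p s).eval y) (p'.eval y) t := by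
  have e : ∀ q : ℝ[X], q.natDegree ≤ k → q.eval y
      = ∑ i ∈ Finset.range (k + 1), q.coeff i * y ^ i := fun q hq =>
    eval_eq_sum_range' (by omega) y
  simp only [fun s => e _ (hd s)]
  rw [e _ hd']
  exact HasDerivAt.fun_sum (fun m _ => (h m).mul_const _)

lemma coeff_diff {k : ℕ} {p : ℝ → ℝ[X]} (hd : ∀ t, (p t).natDegree ≤ k)
    (h : ∀ y, Differentiable ℝ (fun t => (p t).eval y)) (i : ℕ) :
    Differentiable ℝ (fun t => (p t).coeff i) := by
  have e : ∀ t, p t = ∑ m ∈ Finset.range (k + 1), C ((p t).eval (m:ℝ)) *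
      Lagrange.basis (Finset.range (k + 1)) (fun m : ℕ => (m:ℝ)) m := by
    intro t
    have := Lagrange.eq_interpolate (s := Finset.range (k + 1)) (v := fun m : ℕ => (m:ℝ)) (f := p t)
      (fun a _ b _ hab => Nat.cast_injective hab)
      (by rw [Finset.card_range]; exact degree_lt_of_natDegree_le (hd t))
    rw [Lagrange.interpolate_apply] at this
    exact this
  have e2 : (fun t => (p t).coeff i) = fun t => ∑ m ∈ Finset.range (k + 1), (p t).eval (m:ℝ) *
      (Lagrange.basis (Finset.range (k + 1)) (fun m : ℕ => (m:ℝ)) m).coeff i := by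
    funext t
    conv_lhs => rw [e t]
    rw [finsetSum_coeff]
    simp only [coeff_C_mul]
  rw [e2]
  exact Differentiable.fun_sum (fun m _ => (h _).mul_const _)

/-- time derivative of the Gauss–Radau projection. -/
lemma P_deriv {a b : ℝ} (hab : a < b) {k : ℕ} (hk : 1 ≤ k) {u0 : ℝ → ℝ} (hu : ContDiff ℝ 1 u0)
    {P : ℝ → ℝ[X]} (hP : ∀ t, IsGRProj k a b (fun y => u0 (y - t)) (P t)) (t : ℝ) :
    ∃ P' : ℝ[X], P'.natDegree ≤ k ∧ HasPD P P' t ∧ ∀ v : ℝ[X], v.natDegree ≤ k →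
      pI a b (P' * v) = (∫ x in a..b, -(deriv u0 (x - t)) * v.eval x)
        + Gfun k a b u0 1 t * pI a b (Lc a b k * v) := by
  have hc : ∀ t, Continuous (fun y => u0 (y - t)) := fun t =>
    hu.continuous.comp (continuous_id.sub continuous_const)
  have hG : HasDerivAt (fun s => radauCoeff a b (fun y => u0 (y - s)) (k + 1))
      (Gfun k a b u0 1 t) t := by
    have := radau_deriv hab hu (k+1) t
    refine this.congr_deriv ?_
    rw [Gfun, iteratedDeriv_one, this.deriv]
  have hI : ∀ v : ℝ[X], v.natDegree ≤ k → HasDerivAt (fun s => pI a b (P s * v))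
      ((∫ x in a..b, -(deriv u0 (x - t)) * v.eval x)
        + Gfun k a b u0 1 t * pI a b (Lc a b k * v)) t := by
    intro v hv
    simp only [fun s => GR_key hab hk (hc s) (hP s) v hv]
    exact (hasDeriv_int_shift hu v.continuous a b t).add (hG.mul_const _)
  have e : P = fun s => ∑ m ∈ Finset.range (k + 1),
      C ((2 * (m:ℝ) + 1) / (b - a) * pI a b (P s * Lc a b m)) * Lc a b m := by
    funext s
    exact Lc_expand hab (k+1) (P s) (degree_lt_of_natDegree_le (hP s).1)
  have hdiff : ∀ i, DifferentiableAt ℝ (fun s => (P s).coeff i) t := by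
    intro i
    have e2 : (fun s => (P s).coeff i) = fun s => ∑ m ∈ Finset.range (k + 1),
        ((2 * (m:ℝ) + 1) / (b - a) * pI a b (P s * Lc a b m)) * (Lc a b m).coeff i := by
      funext s
      conv_lhs => rw [congrFun e s]
      simp only [finsetSum_coeff, coeff_C_mul]
    rw [e2]
    refine (HasDerivAt.fun_sum (fun m hm => (((hI (Lc a b m) ?_).const_mul _).mul_const _))).differentiableAt
    exact (Lc_natDegree_le a b m).trans (by have := Finset.mem_range.mp hm; omega)
  obtain ⟨P', h1, h2⟩ := exists_HasPD (fun s => (hP s).1) hdiff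
  refine ⟨P', h1, h2, fun v hv => ?_⟩
  exact (h2.pI_mul (fun s => (hP s).1) h1 a b v).unique (hI v hv)

/-- the error polynomial on a cell. -/
noncomputable def xiP (k : ℕ) (a b : ℝ) (u0 : ℝ → ℝ) (P : ℝ → ℝ[X]) (F : ℕ → ℝ[X])
    (l : ℕ) (U : ℝ → ℝ[X]) (t : ℝ) : ℝ[X] :=
  P t - (∑ i ∈ Finset.Icc 1 l, C (((b - a) / 2) ^ i * Gfun k a b u0 i t) * F i) - U t

lemma xiP_eval (k : ℕ) (a b : ℝ) (u0 : ℝ → ℝ) (P : ℝ → ℝ[X]) (F : ℕ → ℝ[X])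
    (l : ℕ) (U : ℝ → ℝ[X]) (t y : ℝ) :
    (xiP k a b u0 P F l U t).eval y = uIl k a b u0 P F l y t - (U t).eval y := by
  simp [xiP, uIl, wSum, wFun, eval_finsetSum]

lemma tele_W {a b : ℝ} (hab : a < b) {k : ℕ} (hk : 1 ≤ k) {F : ℕ → ℝ[X]} (hF : IsFSeq k a b F)
    (g : ℕ → ℝ) (v : ℝ[X]) (hv : v.natDegree ≤ k) (l : ℕ) (hl : 1 ≤ l) (hlk : l ≤ k) :
    ∑ i ∈ Finset.Icc 1 l, (((b - a) / 2) ^ i * g (i + 1) * pI a b (F i * v)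
      - ((b - a) / 2) ^ i * g i * pI a b (F i * derivative v))
    = ((b - a) / 2) ^ l * g (l + 1) * pI a b (F l * v) + g 1 * pI a b (Lc a b k * v) := by
  have hb : b - a ≠ 0 := by linarith
  induction l, hl using Nat.le_induction with
  | base =>
    simp only [Finset.Icc_self, Finset.sum_singleton]
    rw [F_one_ibp hab hk hF v hv]
    field_simp; ring
  | succ l hl ih =>
    rw [Finset.sum_Icc_succ_top (by omega), ih (by omega), F_succ_ibp hab hk hF l hl hlk v hv, pow_succ]
    field_simp; ring

/-- weak form of the error equation on one cell. -/
lemma cell_eq {a b : ℝ} (hab : a < b) {k l : ℕ} (hk : 1 ≤ k) (hl : 1 ≤ l) (hlk : l ≤ k)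
    {u0 : ℝ → ℝ} (hu : ContDiff ℝ (k + l + 2 : ℕ) u0) {P : ℝ → ℝ[X]}
    (hP : ∀ t, IsGRProj k a b (fun y => u0 (y - t)) (P t))
    {F : ℕ → ℝ[X]} (hF : IsFSeq k a b F) {U : ℝ → ℝ[X]} (hU : ∀ t, (U t).natDegree ≤ k)
    (hU2 : ∀ y, ContDiff ℝ 1 (fun t => (U t).eval y)) (t uin : ℝ)
    (hDG : ∀ v : ℝ[X], v.natDegree ≤ k →
      (∫ y in a..b, deriv (fun s => (U s).eval y) t * v.eval y)
      - (∫ y in a..b, (U t).eval y * v.derivative.eval y)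
      + (U t).eval b * v.eval b - uin * v.eval a = 0) :
    (∀ s, (xiP k a b u0 P F l U s).natDegree ≤ k) ∧
    ((xiP k a b u0 P F l U t).eval b = u0 (b - t) - (U t).eval b) ∧
    ∃ ξ' : ℝ[X], HasDerivAt (fun s => pI a b (xiP k a b u0 P F l U s * xiP k a b u0 P F l U s))
        (2 * pI a b (ξ' * xiP k a b u0 P F l U t)) t ∧
      ∀ v : ℝ[X], v.natDegree ≤ k →
        pI a b (ξ' * v) - pI a b (xiP k a b u0 P F l U t * derivative v)
          + (xiP k a b u0 P F l U t).eval b * v.eval b - (u0 (a - t) - uin) * v.eval a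
        = - (((b - a) / 2) ^ l * Gfun k a b u0 (l + 1) t * pI a b (F l * v)) := by
  have hu1 : ContDiff ℝ 1 u0 := hu.of_le (by exact_mod_cast (by omega : 1 ≤ k + l + 2))
  have hdeg : ∀ g : ℕ → ℝ, (∑ i ∈ Finset.Icc 1 l, C (g i) * F i).natDegree ≤ k := fun g =>
    natDegree_sum_le_of_forall_le _ _ (fun i hi =>
      (natDegree_C_mul_le _ _).trans (F_natDegree hF i (Finset.mem_Icc.mp hi).1))
  have hsub : ∀ p q : ℝ[X], p.natDegree ≤ k → q.natDegree ≤ k → (p - q).natDegree ≤ k :=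
    fun p q hp hq => (natDegree_sub_le_of_le hp hq).trans (by simp)
  have hxd : ∀ s, (xiP k a b u0 P F l U s).natDegree ≤ k := fun s =>
    hsub _ _ (hsub _ _ (hP s).1 (hdeg _)) (hU s)
  have hWb : ∀ g : ℕ → ℝ, (∑ i ∈ Finset.Icc 1 l, C (g i) * F i).eval b = 0 := by
    intro g
    rw [eval_finsetSum]
    refine Finset.sum_eq_zero (fun i hi => ?_)
    rw [Finset.mem_Icc] at hi
    rw [eval_mul, F_right hab hk hF i hi.1 (by omega), mul_zero]
  have hxb : (xiP k a b u0 P F l U t).eval b = u0 (b - t) - (U t).eval b := by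
    rw [xiP, eval_sub, eval_sub, hWb, (hP t).2.2, sub_zero]
  refine ⟨hxd, hxb, ?_⟩
  obtain ⟨P', hP'd, hP', hP'v⟩ := P_deriv hab hk hu1 hP t
  obtain ⟨U', hU'd, hU'⟩ := exists_HasPD hU (t := t) (fun i =>
    (coeff_diff hU (fun y => (hU2 y).differentiable one_ne_zero) i).differentiableAt)
  have hW' : HasPD (fun s => ∑ i ∈ Finset.Icc 1 l, C (((b - a) / 2) ^ i * Gfun k a b u0 i s) * F i)
      (∑ i ∈ Finset.Icc 1 l, C (((b - a) / 2) ^ i * Gfun k a b u0 (i + 1) t) * F i) t :=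
    HasPD.sum_C_mul _ _ (fun i hi => (Gfun_deriv hab k hu i (by
      have := Finset.mem_Icc.mp hi; omega) t).const_mul _)
  set W' := ∑ i ∈ Finset.Icc 1 l, C (((b - a) / 2) ^ i * Gfun k a b u0 (i + 1) t) * F i with hW'def
  have hxi' : HasPD (xiP k a b u0 P F l U) (P' - W' - U') t := (hP'.sub hW').sub hU'
  have hxi'd : (P' - W' - U').natDegree ≤ k := hsub _ _ (hsub _ _ hP'd (hdeg _)) hU'd
  refine ⟨P' - W' - U', hxi'.pI_sq hxd hxi'd a b, ?_⟩
  intro v hv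
  have hDGv := hDG v hv
  have hder : ∀ y, deriv (fun s => (U s).eval y) t = U'.eval y := fun y =>
    (hU'.eval hU hU'd y).deriv
  simp only [hder] at hDGv
  have q1 : (∫ y in a..b, U'.eval y * v.eval y) = pI a b (U' * v) := by
    rw [pI_apply]; simp only [eval_mul]
  have q2 : (∫ y in a..b, (U t).eval y * v.derivative.eval y) = pI a b (U t * derivative v) := by
    rw [pI_apply]; simp only [eval_mul]
  rw [q1, q2] at hDGv
  have hPv := hP'v v hv
  have hPdv : pI a b (P t * derivative v) = ∫ x in a..b, u0 (x - t) * (derivative v).eval x := by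
    have hd := natDegree_derivative_le v
    have := (hP t).2.1 (derivative v) (by omega)
    rw [← this, pI_apply]; simp only [eval_mul]
  have hibp : (∫ x in a..b, u0 (x - t) * (derivative v).eval x)
      = u0 (b - t) * v.eval b - u0 (a - t) * v.eval a - ∫ x in a..b, deriv u0 (x - t) * v.eval x := by
    refine intervalIntegral.integral_mul_deriv_eq_deriv_mul (u := fun x => u0 (x - t))
      (u' := fun x => deriv u0 (x - t)) (v := fun x => v.eval x)
      (fun x _ => ?_) (fun x _ => v.hasDerivAt x) ?_
      ((derivative v).continuous.intervalIntegrable _ _)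
    · have h1 : HasDerivAt u0 (deriv u0 (x - t)) (x - t) :=
        (hu1.differentiable one_ne_zero).differentiableAt.hasDerivAt
      exact h1.comp_sub_const x t
    · have := hu1.continuous_deriv le_rfl
      exact (by fun_prop : Continuous (fun x => deriv u0 (x - t))).intervalIntegrable _ _
  have hneg : (∫ x in a..b, -(deriv u0 (x - t)) * v.eval x)
      = - ∫ x in a..b, deriv u0 (x - t) * v.eval x := by
    simp only [neg_mul, intervalIntegral.integral_neg]
  have hWsum : ∀ (g : ℕ → ℝ) (q : ℝ[X]), pI a b ((∑ i ∈ Finset.Icc 1 l, C (g i) * F i) * q)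
      = ∑ i ∈ Finset.Icc 1 l, g i * pI a b (F i * q) := by
    intro g q
    rw [Finset.sum_mul, map_sum]
    refine Finset.sum_congr rfl (fun i _ => ?_)
    rw [mul_assoc, pI_C_mul]
  have htele := tele_W hab hk hF (fun i => Gfun k a b u0 i t) v hv l hl hlk
  rw [Finset.sum_sub_distrib] at htele
  rw [hxb]
  have hx1 : pI a b (xiP k a b u0 P F l U t * derivative v) = pI a b (P t * derivative v)
      - ∑ i ∈ Finset.Icc 1 l, ((b - a) / 2) ^ i * Gfun k a b u0 i t * pI a b (F i * derivative v)
      - pI a b (U t * derivative v) := by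
    rw [xiP, sub_mul, sub_mul, map_sub, map_sub, hWsum]
  have hx2 : pI a b ((P' - W' - U') * v) = pI a b (P' * v)
      - ∑ i ∈ Finset.Icc 1 l, ((b - a) / 2) ^ i * Gfun k a b u0 (i + 1) t * pI a b (F i * v)
      - pI a b (U' * v) := by
    rw [sub_mul, sub_mul, map_sub, map_sub, hW'def, hWsum]
  rw [hx1, hx2, hPv, hPdv, hibp, hneg]
  linear_combination -hDGv - htele

/-! ### Final differential inequality -/

lemma sqrt_gronwall {E E' : ℝ → ℝ} {R T : ℝ} (hE : ∀ t, 0 ≤ E t) (hR : 0 ≤ R)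
    (hd : ∀ t ∈ Set.Icc (0:ℝ) T, HasDerivAt E (E' t) t)
    (hb : ∀ t ∈ Set.Icc (0:ℝ) T, E' t ≤ 2 * R * Real.sqrt (E t)) :
    ∀ t ∈ Set.Icc (0:ℝ) T, Real.sqrt (E t) ≤ Real.sqrt (E 0) + R * t := by
  intro t ht
  have key : ∀ ε > 0, Real.sqrt (E t + ε) ≤ Real.sqrt (E 0 + ε) + R * t := by
    intro ε hε
    have hder : ∀ s ∈ Set.Icc (0:ℝ) T, HasDerivAt (fun s => Real.sqrt (E s + ε) - R * s)
        (E' s / (2 * Real.sqrt (E s + ε)) - R) s := by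
      intro s hs
      have h1 := ((hd s hs).add_const ε).sqrt (by have := hE s; positivity)
      have h2 : HasDerivAt (fun s => R * s) R s := by
        simpa using (hasDerivAt_id s).const_mul R
      exact h1.sub h2
    have hanti : AntitoneOn (fun s => Real.sqrt (E s + ε) - R * s) (Set.Icc 0 T) := by
      apply antitoneOn_of_deriv_nonpos (convex_Icc 0 T)
      · exact fun s hs => (hder s hs).continuousAt.continuousWithinAt
      · exact fun s hs => (hder s (interior_subset hs)).differentiableAt.differentiableWithinAt
      · intro s hs
        have hs' := interior_subset hs
        rw [(hder s hs').deriv]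
        have hpos : 0 < Real.sqrt (E s + ε) := Real.sqrt_pos.mpr (by have := hE s; positivity)
        have hle : Real.sqrt (E s) ≤ Real.sqrt (E s + ε) := Real.sqrt_le_sqrt (by linarith)
        rw [sub_nonpos, div_le_iff₀ (by positivity)]
        have := hb s hs'
        nlinarith
    have := hanti (Set.left_mem_Icc.mpr (ht.1.trans ht.2)) ht ht.1
    simp only [mul_zero, sub_zero] at this
    linarith
  have hlim : ∀ x : ℝ, Filter.Tendsto (fun ε => Real.sqrt (x + ε)) (nhdsWithin 0 (Set.Ioi 0))
      (nhds (Real.sqrt x)) := by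
    intro x
    have : Continuous (fun ε => Real.sqrt (x + ε)) := by fun_prop
    have h2 := this.tendsto 0
    rw [add_zero] at h2
    exact h2.mono_left nhdsWithin_le_nhds
  refine le_of_tendsto_of_tendsto (hlim (E t)) ((hlim (E 0)).add_const (R * t)) ?_
  filter_upwards [self_mem_nhdsWithin] with ε hε
  exact key ε hε

lemma tele_Icc (f : ℕ → ℝ) (N : ℕ) : ∑ j ∈ Finset.Icc 1 N, (f (j - 1) - f j) = f 0 - f N := by
  induction N with
  | zero => simp
  | succ n ih => rw [Finset.sum_Icc_succ_top (by omega), ih]; simp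

lemma cauchy_cells {N : ℕ} {x : ℕ → ℝ} (hx : ∀ j ∈ Finset.Icc 1 N, x (j-1) < x j)
    (r q : ℕ → ℝ[X]) :
    (∑ j ∈ Finset.Icc 1 N, pI (x (j-1)) (x j) (r j * q j)) ^ 2
      ≤ (∑ j ∈ Finset.Icc 1 N, pI (x (j-1)) (x j) (r j * r j))
        * (∑ j ∈ Finset.Icc 1 N, pI (x (j-1)) (x j) (q j * q j)) := by
  set A := ∑ j ∈ Finset.Icc 1 N, pI (x (j-1)) (x j) (r j * r j) with hA
  set B := ∑ j ∈ Finset.Icc 1 N, pI (x (j-1)) (x j) (r j * q j) with hB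
  set D := ∑ j ∈ Finset.Icc 1 N, pI (x (j-1)) (x j) (q j * q j) with hD
  have h : ∀ z : ℝ, 0 ≤ D * (z * z) + (2 * B) * z + A := by
    intro z
    have h0 : 0 ≤ ∑ j ∈ Finset.Icc 1 N, pI (x (j-1)) (x j) ((r j + C z * q j) * (r j + C z * q j)) :=
      Finset.sum_nonneg (fun j hj => pI_sq_nonneg (hx j hj).le _)
    have e : ∑ j ∈ Finset.Icc 1 N, pI (x (j-1)) (x j) ((r j + C z * q j) * (r j + C z * q j))
        = A + 2 * z * B + z * z * D := by
      rw [hA, hB, hD, Finset.mul_sum, Finset.mul_sum, ← Finset.sum_add_distrib,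
        ← Finset.sum_add_distrib]
      refine Finset.sum_congr rfl (fun j _ => ?_)
      rw [show (r j + C z * q j) * (r j + C z * q j)
        = r j * r j + C (2 * z) * (r j * q j) + C (z * z) * (q j * q j) by
          simp only [C_mul, show (C (2:ℝ)) = (2:ℝ[X]) from rfl]; ring]
      rw [map_add, map_add, pI_C_mul, pI_C_mul]
    rw [e] at h0
    linarith
  have := discrim_le_zero h
  rw [discrim] at this
  nlinarith

/-- supercloseness `‖u_I^l(·,t) - u_h(·,t)‖₀ ≤ ‖u_I^l(·,0) - u_h(·,0)‖₀
+ C t h^{k+l+1} M_{k+l+2}`, for either the periodic upwind flux or the Dirichlet inflow flux. -/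
theorem stmt11 (k l : ℕ) (hk : 1 ≤ k) (hl1 : 1 ≤ l) (hlk : l ≤ k)
    (c : ℝ) (hc : 1 ≤ c) :
    ∃ C : ℝ, 0 < C ∧
      ∀ (N : ℕ) (x : ℕ → ℝ) (h T : ℝ), 1 ≤ N → x 0 = 0 → x N = 2 * Real.pi →
        (∀ j < N, x j < x (j+1)) →
        (∀ j ∈ Finset.Icc 1 N, x j - x (j-1) ≤ h) →
        (∀ j ∈ Finset.Icc 1 N, h ≤ c * (x j - x (j-1))) →
        0 < T →
        ∀ u0 : ℝ → ℝ, ContDiff ℝ (k+l+2) u0 →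
        ∀ M : ℝ,
          (∀ i ≤ k+l+2, ∀ y ∈ Set.Icc (-T) (2 * Real.pi), |iteratedDeriv i u0 y| ≤ M) →
        ∀ P : ℕ → ℝ → Polynomial ℝ,
          (∀ j ∈ Finset.Icc 1 N, ∀ t : ℝ,
            IsGRProj k (x (j-1)) (x j) (fun y => u0 (y - t)) (P j t)) →
        ∀ F : ℕ → ℕ → Polynomial ℝ,
          (∀ j ∈ Finset.Icc 1 N, IsFSeq k (x (j-1)) (x j) (F j)) →
        ∀ (inflow : ℝ → ℝ) (uh : ℕ → ℝ → Polynomial ℝ),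
          IsDGSol k N x T inflow uh →
          (((∀ t, inflow t = (uh N t).eval (x N))
              ∧ (∀ y : ℝ, u0 (y + 2 * Real.pi) = u0 y))
            ∨ (∀ t, inflow t = u0 (-t))) →
        ∀ t ∈ Set.Icc (0:ℝ) T,
          Real.sqrt (∑ j ∈ Finset.Icc 1 N, ∫ y in (x (j-1))..(x j),
              (uIl k (x (j-1)) (x j) u0 (P j) (F j) l y t - (uh j t).eval y)^2)
            ≤ Real.sqrt (∑ j ∈ Finset.Icc 1 N, ∫ y in (x (j-1))..(x j),
                (uIl k (x (j-1)) (x j) u0 (P j) (F j) l y 0 - (uh j 0).eval y)^2)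
              + C * t * h^(k+l+1) * M := by
  obtain ⟨Cf, hCf0, hCf⟩ := F_bound k l hk hl1
  obtain ⟨Kg, hKg0, hKg⟩ := G_bound k l
  set C0 : ℝ := Kg * Real.sqrt (Cf * (2 * Real.pi)) with hC0
  have hC00 : 0 ≤ C0 := mul_nonneg hKg0 (Real.sqrt_nonneg _)
  refine ⟨C0 + 1, by linarith, ?_⟩
  intro N x h T hN hx0 hxN hmono hxh _hqu hT u0 hu M hM P hP F hF inflow uh hDG hbc t ht
  have hu' : ContDiff ℝ (k + l + 2 : ℕ) u0 := by exact_mod_cast hu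
  have hcell : ∀ j ∈ Finset.Icc 1 N, x (j-1) < x j := by
    intro j hj
    rw [Finset.mem_Icc] at hj
    have := hmono (j-1) (by omega)
    rwa [Nat.sub_add_cancel hj.1] at this
  have hmn : ∀ i j, i ≤ j → j ≤ N → x i ≤ x j := by
    intro i j hij
    induction j, hij using Nat.le_induction with
    | base => intro _; exact le_rfl
    | succ j hij ih => intro hj; exact (ih (by omega)).trans (hmono j (by omega)).le
  have hM0 : 0 ≤ M := (abs_nonneg _).trans (hM 0 (by omega) 0 ⟨by linarith, by positivity⟩)
  have hhpos : 0 < h := by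
    have h1 : 1 ∈ Finset.Icc 1 N := Finset.mem_Icc.mpr ⟨le_rfl, hN⟩
    linarith [hcell 1 h1, hxh 1 h1]
  -- the error polynomials
  set ξ : ℕ → ℝ → Polynomial ℝ := fun j =>
    xiP k (x (j-1)) (x j) u0 (P j) (F j) l (uh j) with hξ
  set E : ℝ → ℝ := fun s => ∑ j ∈ Finset.Icc 1 N, pI (x (j-1)) (x j) (ξ j s * ξ j s) with hE
  have hEeq : ∀ s, ∑ j ∈ Finset.Icc 1 N, (∫ y in (x (j-1))..(x j),
      (uIl k (x (j-1)) (x j) u0 (P j) (F j) l y s - (uh j s).eval y)^2) = E s := by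
    intro s
    refine Finset.sum_congr rfl (fun j _ => ?_)
    rw [pI_apply]
    simp only [eval_mul, hξ, xiP_eval, pow_two]
  rw [hEeq, hEeq]
  have hEnn : ∀ s, 0 ≤ E s := fun s =>
    Finset.sum_nonneg (fun j hj => pI_sq_nonneg (hcell j hj).le _)
  set R : ℝ := C0 * h ^ (k + l + 1) * M with hR
  have hR0 : 0 ≤ R := by positivity
  -- residual
  set r : ℕ → ℝ → Polynomial ℝ := fun j s =>
    C (((x j - x (j-1)) / 2) ^ l * Gfun k (x (j-1)) (x j) u0 (l + 1) s) * F j l with hr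
  have hlen : ∑ j ∈ Finset.Icc 1 N, (x j - x (j-1)) = 2 * Real.pi := by
    have := tele_Icc (fun j => - x j) N
    simp only [hx0, hxN] at this
    rw [show (2 * Real.pi) = -0 - -(2 * Real.pi) by ring, ← this]
    refine Finset.sum_congr rfl (fun j _ => ?_)
    ring
  have hA : ∀ s ∈ Set.Icc (0:ℝ) T,
      ∑ j ∈ Finset.Icc 1 N, pI (x (j-1)) (x j) (r j s * r j s) ≤ R ^ 2 := by
    intro s hs
    have hj1 : ∀ j ∈ Finset.Icc 1 N, pI (x (j-1)) (x j) (r j s * r j s)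
        ≤ (Kg * h ^ (k + l + 1) * M) ^ 2 * Cf * (x j - x (j-1)) := by
      intro j hj
      have hab := hcell j hj
      have hlen' := hxh j hj
      have hj' := Finset.mem_Icc.mp hj
      set c' := ((x j - x (j-1)) / 2) ^ l * Gfun k (x (j-1)) (x j) u0 (l + 1) s with hc'
      have hG := hKg _ _ hab u0 hu' M s (fun y hy => by
        refine hM _ le_rfl y ⟨?_, ?_⟩
        · have := hmn 0 (j-1) (by omega) (by omega)
          linarith [hy.1, hs.2]
        · have := hmn j N (by omega) le_rfl
          linarith [hy.2, hs.1])
      have hd0 : 0 < x j - x (j-1) := by linarith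
      have hcb : |c'| ≤ Kg * h ^ (k + l + 1) * M := by
        rw [hc', abs_mul, abs_of_nonneg (by positivity)]
        have e1 : ((x j - x (j-1)) / 2) ^ l ≤ h ^ l :=
          pow_le_pow_left₀ (by positivity) (by linarith) l
        have e2 : (x j - x (j-1)) ^ (k + 1) ≤ h ^ (k + 1) :=
          pow_le_pow_left₀ hd0.le hlen' _
        have e3 : |Gfun k (x (j-1)) (x j) u0 (l + 1) s| ≤ Kg * h ^ (k + 1) * M := by
          refine hG.trans ?_
          gcongr
        calc _ ≤ h ^ l * (Kg * h ^ (k + 1) * M) := by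
              apply mul_le_mul e1 e3 (abs_nonneg _) (by positivity)
          _ = Kg * h ^ (k + l + 1) * M := by ring
      have hsq : c' ^ 2 ≤ (Kg * h ^ (k + l + 1) * M) ^ 2 := by
        rw [← sq_abs]; exact pow_le_pow_left₀ (abs_nonneg _) hcb 2
      have hFb := hCf _ _ hab (F j) (hF j hj)
      have e : r j s * r j s = C (c' ^ 2) * (F j l * F j l) := by
        simp only [hr, C_pow]; ring
      rw [e, pI_C_mul, mul_assoc]
      exact mul_le_mul hsq hFb (pI_sq_nonneg hab.le _) (by positivity)
    refine (Finset.sum_le_sum hj1).trans ?_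
    rw [← Finset.mul_sum, hlen, hR, hC0]
    have : Real.sqrt (Cf * (2 * Real.pi)) ^ 2 = Cf * (2 * Real.pi) :=
      Real.sq_sqrt (by positivity)
    apply le_of_eq
    calc _ = (Kg * h ^ (k + l + 1) * M) ^ 2 * (Cf * (2 * Real.pi)) := by ring
      _ = _ := by
          linear_combination (-(Kg * h ^ (k + l + 1) * M) ^ 2) * this
  -- energy inequality
  have hstep : ∀ s ∈ Set.Icc (0:ℝ) T, ∃ e' : ℝ, HasDerivAt E e' s ∧
      e' ≤ 2 * R * Real.sqrt (E s) := by
    intro s hs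
    have hc : ∀ j ∈ Finset.Icc 1 N, _ := fun j hj =>
      cell_eq (hcell j hj) hk hl1 hlk hu' (hP j hj) (hF j hj) (hDG.1 j hj) (hDG.2.1 j hj) s _
        (hDG.2.2 j hj s hs)
    choose! ξ' hξ'1 hξ'2 using fun j hj => (hc j hj).2.2
    have hβ : ∀ j ∈ Finset.Icc 1 N, (ξ j s).eval (x j) = u0 (x j - s) - (uh j s).eval (x j) :=
      fun j hj => (hc j hj).2.1
    refine ⟨∑ j ∈ Finset.Icc 1 N, 2 * pI (x (j-1)) (x j) (ξ' j * ξ j s), ?_, ?_⟩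
    · exact HasDerivAt.fun_sum (fun j hj => hξ'1 j hj)
    -- boundary values
    set β : ℕ → ℝ := fun j => if j = 0 then u0 (0 - s) - inflow s
      else u0 (x j - s) - (uh j s).eval (x j) with hβdef
    have hcellin : ∀ j ∈ Finset.Icc 1 N, 2 * pI (x (j-1)) (x j) (ξ' j * ξ j s)
        ≤ (β (j-1) ^ 2 - β j ^ 2) + (-2) * pI (x (j-1)) (x j) (r j s * ξ j s) := by
      intro j hj
      have hj' := Finset.mem_Icc.mp hj
      have h1 := hξ'2 j hj (ξ j s) ((hc j hj).1 s)
      have hin : u0 (x (j-1) - s) - (if j = 1 then inflow s else (uh (j-1) s).eval (x (j-1)))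
          = β (j-1) := by
        simp only [hβdef]
        by_cases h : j = 1
        · subst h; simp [hx0]
        · rw [if_neg h, if_neg (by omega)]
      have hout : (ξ j s).eval (x j) = β j := by
        rw [hβ j hj]; simp only [hβdef]; rw [if_neg (by omega)]
      have hself := pI_ibp (x (j-1)) (x j) (ξ j s) (ξ j s)
      rw [mul_comm (derivative (ξ j s))] at hself
      have hrr : pI (x (j-1)) (x j) (r j s * ξ j s)
          = ((x j - x (j-1)) / 2) ^ l * Gfun k (x (j-1)) (x j) u0 (l + 1) s
            * pI (x (j-1)) (x j) (F j l * ξ j s) := by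
        simp only [hr]; rw [mul_assoc, pI_C_mul]
      rw [← hrr, hin] at h1
      change pI (x (j-1)) (x j) (ξ' j * ξ j s) - pI (x (j-1)) (x j) (ξ j s * derivative (ξ j s))
        + (ξ j s).eval (x j) * (ξ j s).eval (x j) - β (j-1) * (ξ j s).eval (x (j-1)) = _ at h1
      rw [hout] at h1 hself
      nlinarith [sq_nonneg (β (j-1) - (ξ j s).eval (x (j-1)))]
    have hbd : β 0 ^ 2 - β N ^ 2 ≤ 0 := by
      have hN0 : N ≠ 0 := by omega
      rcases hbc with ⟨hin, hper⟩ | hin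
      · have : β 0 = β N := by
          simp only [hβdef, if_neg hN0, if_pos, hin]
          have := hper (0 - s)
          rw [hxN, show 2 * Real.pi - s = 0 - s + 2 * Real.pi by ring, this]
        rw [this]; simp
      · have : β 0 = 0 := by simp [hβdef, hin]
        rw [this]; nlinarith [sq_nonneg (β N)]
    have hsum := Finset.sum_le_sum hcellin
    rw [Finset.sum_add_distrib, tele_Icc (fun j => β j ^ 2) N, ← Finset.mul_sum] at hsum
    have hcs := cauchy_cells hcell (fun j => r j s) (fun j => ξ j s)
    have hcs2 : (∑ j ∈ Finset.Icc 1 N, pI (x (j-1)) (x j) (r j s * ξ j s)) ^ 2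
        ≤ (R * Real.sqrt (E s)) ^ 2 := by
      refine hcs.trans ?_
      rw [mul_pow, Real.sq_sqrt (hEnn s)]
      exact mul_le_mul_of_nonneg_right (hA s hs) (hEnn s)
    have habs := abs_le_of_sq_le_sq hcs2 (by positivity)
    have hlo := (abs_le.mp habs).1
    rw [← Finset.mul_sum] at hsum ⊢
    try rw [← Finset.mul_sum] at hsum
    linarith
  choose! E' hE'1 hE'2 using hstep
  have hfin := sqrt_gronwall hEnn hR0 hE'1 hE'2 t ht
  refine hfin.trans ?_
  have : R * t ≤ (C0 + 1) * t * h ^ (k + l + 1) * M := by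
    have h2 : 0 ≤ t * h ^ (k + l + 1) * M := mul_nonneg (mul_nonneg ht.1 (by positivity)) hM0
    rw [hR]; nlinarith
  linarith
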